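/- (Theorem 3, transverse instability on the stripe lattice with κ = 1.) Let μ = 1 and ε > 0, and let ψ ∈ l²(ℤ, ℝ) with ψ_m > 0 for all m ∈ ℤ be a solution of the stationary 1D dNLS equation −ψ_m + ε(ψ_{m+1} + ψ_{m−1} − 2ψ_m) + ψ_m³ = 0 such that the self-adjoint operator L₊(0) on l²(ℤ, ℝ) (given by (L₊(0)U)_m = −ε(U_{m+1} + U_{m−1} − 2U_m) + U_m − 3ψ_m²U_m) has exactly one negative eigenvalue −β with β > 0, trivial kernel, and L₊(0) + β ≥ 0. Set p₀ = √β. Then for every p with 0 < |p| < p₀ there exist λ > 0 and a nonzero pair (U, W) ∈ l²(ℤ, ℝ)² with L₊(p)U = −λW and L₋(p)W = λU, where L₊(p) = L₊(0) + p² and L₋(p) = L₋(0) + p² are the κ = 1 stripe-lattice operators; hence the fundamental line soliton is transversely unstable. -/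

import Mathlib

open scoped InnerProductSpace

section Hilbert

variable {H : Type*} [NormedAddCommGroup H] [InnerProductSpace ℝ H]

/-- A bounded operator whose quadratic form is bounded below by `c > 0` is invertible. -/
theorem ContinuousLinearMap.exists_equiv_of_coercive [CompleteSpace H] (P : H →L[ℝ] H)
    {c : ℝ} (hc : 0 < c) (hP : ∀ x, c * ‖x‖ ^ 2 ≤ ⟪P x, x⟫_ℝ) : ∃ e : H ≃L[ℝ] H, (e : H →L[ℝ] H) = P := by
  have hB : IsCoercive ((innerSL ℝ (E := H)).comp P) := by
    refine ⟨c, hc, fun u => ?_⟩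
    simpa [pow_two, mul_assoc] using hP u
  refine ⟨hB.continuousLinearEquivOfBilin, ?_⟩
  ext v
  refine (hB.unique_continuousLinearEquivOfBilin (v := v) (f := P v) fun w => ?_).symm
  simp

/-- For a symmetric operator with nonnegative quadratic form, `‖G x‖²` is controlled by
`⟪G x, x⟫`. -/
theorem ContinuousLinearMap.norm_sq_apply_le_inner (G : H →L[ℝ] H)
    (hsymm : ∀ x y, ⟪G x, y⟫_ℝ = ⟪x, G y⟫_ℝ) (hnonneg : ∀ x, 0 ≤ ⟪G x, x⟫_ℝ) (x : H) :
    ‖G x‖ ^ 2 ≤ (‖G‖ + 1) * ⟪G x, x⟫_ℝ := by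
  have hg : 0 < ‖G‖ + 1 := by positivity
  have h := hnonneg (x - (‖G‖ + 1)⁻¹ • G x)
  have h1 : ⟪G (G x), x⟫_ℝ = ‖G x‖ ^ 2 := by rw [hsymm, real_inner_self_eq_norm_sq]
  have h2 : ⟪G (G x), G x⟫_ℝ ≤ (‖G‖ + 1) * ‖G x‖ ^ 2 := by
    calc ⟪G (G x), G x⟫_ℝ ≤ ‖G (G x)‖ * ‖G x‖ := real_inner_le_norm _ _
      _ ≤ (‖G‖ * ‖G x‖) * ‖G x‖ := by gcongr; exact G.le_opNorm _
      _ ≤ (‖G‖ + 1) * ‖G x‖ ^ 2 := by nlinarith [sq_nonneg ‖G x‖]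
  simp only [map_sub, map_smul, inner_sub_left, inner_sub_right, real_inner_smul_left,
    real_inner_smul_right, h1, real_inner_self_eq_norm_sq] at h
  have h3 := mul_le_mul_of_nonneg_left h2 (by positivity : 0 ≤ (‖G‖ + 1)⁻¹ * (‖G‖ + 1)⁻¹)
  have h4 : (‖G‖ + 1)⁻¹ * ‖G x‖ ^ 2 ≤ ⟪G x, x⟫_ℝ := by
    have h5 : (‖G‖ + 1)⁻¹ * (‖G‖ + 1)⁻¹ * ((‖G‖ + 1) * ‖G x‖ ^ 2)
        = (‖G‖ + 1)⁻¹ * ‖G x‖ ^ 2 := by field_simp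
    nlinarith
  rwa [inv_mul_le_iff₀ hg] at h4

/-- An injective compact perturbation of a coercive operator that is symmetric with nonnegative
quadratic form is itself coercive. -/
theorem ContinuousLinearMap.coercive_of_injective_of_compact_perturbation [CompleteSpace H]
    (P C : H →L[ℝ] H)
    {c : ℝ} (hc : 0 < c) (hP : ∀ x, c * ‖x‖ ^ 2 ≤ ⟪P x, x⟫_ℝ) (hC : IsCompactOperator C)
    (hsymm : ∀ x y, ⟪(P - C) x, y⟫_ℝ = ⟪x, (P - C) y⟫_ℝ)
    (hnonneg : ∀ x, 0 ≤ ⟪(P - C) x, x⟫_ℝ) (hinj : ∀ x, (P - C) x = 0 → x = 0) :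
    ∃ d > (0 : ℝ), ∀ x, d * ‖x‖ ^ 2 ≤ ⟪(P - C) x, x⟫_ℝ := by
  obtain ⟨e, he⟩ := P.exists_equiv_of_coercive hc hP
  have hPe : ∀ x, P x = e x := fun x => by rw [← he]; rfl
  have hK : IsCompactOperator ((e.symm : H →L[ℝ] H) ∘L C) := hC.clm_comp (e.symm : H →L[ℝ] H)
  obtain ⟨K, hK⟩ := hK.antilipschitz_of_not_hasEigenvalue one_ne_zero (by
    intro hev
    obtain ⟨v, hv⟩ := hev.exists_hasEigenvector
    have h1 : e.symm (C v) = v := by simpa using hv.apply_eq_smul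
    refine hv.2 (hinj v ?_)
    rw [sub_apply, hPe, sub_eq_zero, ← h1, e.apply_symm_apply, h1])
  have hbound : ∀ x, ‖x‖ ≤ (K * ‖(e.symm : H →L[ℝ] H)‖) * ‖(P - C) x‖ := by
    intro x
    have h1 := hK.le_mul_dist x 0
    have h2 : (((e.symm : H →L[ℝ] H) ∘L C) - (1 : ℝ) • 1 : H →L[ℝ] H) x
        = -((e.symm : H →L[ℝ] H) ((P - C) x)) := by
      simp [hPe]
    rw [map_zero, dist_zero_right, dist_zero_right, h2, norm_neg] at h1
    calc ‖x‖ ≤ K * ‖(e.symm : H →L[ℝ] H) ((P - C) x)‖ := h1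
      _ ≤ K * (‖(e.symm : H →L[ℝ] H)‖ * ‖(P - C) x‖) := by
        gcongr; exact ContinuousLinearMap.le_opNorm _ _
      _ = _ := by ring
  set M : ℝ := K * ‖(e.symm : H →L[ℝ] H)‖ with hM
  have hM0 : 0 ≤ M := by positivity
  refine ⟨((M ^ 2 + 1) * (‖P - C‖ + 1))⁻¹, by positivity, fun x => ?_⟩
  rw [inv_mul_le_iff₀ (by positivity)]
  calc ‖x‖ ^ 2 ≤ (M * ‖(P - C) x‖) ^ 2 := by gcongr; exact hbound x
    _ ≤ (M ^ 2 + 1) * ‖(P - C) x‖ ^ 2 := by nlinarith [sq_nonneg ‖(P - C) x‖]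
    _ ≤ (M ^ 2 + 1) * ((‖P - C‖ + 1) * ⟪(P - C) x, x⟫_ℝ) := by
      gcongr; exact (P - C).norm_sq_apply_le_inner hsymm hnonneg x
    _ = _ := by ring

/-- If `A` is symmetric and coercive, and `T - C` is symmetric with `T` nonnegative and `C` compact,
and the quadratic form of `T - C` takes a negative value, then `(T - C) A` has a negative
eigenvalue. -/
theorem ContinuousLinearMap.exists_neg_eigenvalue_mul_of_coercive [CompleteSpace H]
    (A T C : H →L[ℝ] H)
    {a : ℝ} (ha : 0 < a) (hA : ∀ x, a * ‖x‖ ^ 2 ≤ ⟪A x, x⟫_ℝ)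
    (hAsymm : ∀ x y, ⟪A x, y⟫_ℝ = ⟪x, A y⟫_ℝ)
    (hT : ∀ x, 0 ≤ ⟪T x, x⟫_ℝ) (hC : IsCompactOperator C)
    (hsymm : ∀ x y, ⟪(T - C) x, y⟫_ℝ = ⟪x, (T - C) y⟫_ℝ)
    (hneg : ∃ x, ⟪(T - C) x, x⟫_ℝ < 0) :
    ∃ s > (0 : ℝ), ∃ w ≠ 0, (T - C) (A w) = -s • w := by
  have hA0 : ∀ x, 0 ≤ ⟪A x, x⟫_ℝ := fun x => le_trans (by positivity) (hA x)
  obtain ⟨e, he⟩ := A.exists_equiv_of_coercive ha hA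
  have hAe : ∀ x, A x = e x := fun x => by rw [← he]; rfl
  set B : H →L[ℝ] H := T - C with hB
  let q : ℝ → H → ℝ := fun s x => ⟪B (A x), A x⟫_ℝ + s * ⟪A x, x⟫_ℝ
  let S : Set ℝ := {s | ∀ x, 0 ≤ q s x}
  obtain ⟨x₀, hx₀⟩ := hneg
  have hSpos : ∀ s ∈ S, 0 < s := by
    intro s hs
    by_contra! hs0
    have h1 := hs (e.symm x₀)
    simp only [q, hAe, e.apply_symm_apply] at h1
    have h2 := hA0 (e.symm x₀)
    simp only [hAe, e.apply_symm_apply] at h2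
    nlinarith
  have hSne : S.Nonempty := by
    refine ⟨‖B‖ * ‖A‖ ^ 2 / a, fun x => ?_⟩
    have h1 : |⟪B (A x), A x⟫_ℝ| ≤ ‖B‖ * ‖A‖ ^ 2 * ‖x‖ ^ 2 := by
      calc |⟪B (A x), A x⟫_ℝ| ≤ ‖B (A x)‖ * ‖A x‖ := abs_real_inner_le_norm _ _
        _ ≤ (‖B‖ * ‖A x‖) * ‖A x‖ := by gcongr; exact B.le_opNorm _
        _ = ‖B‖ * ‖A x‖ ^ 2 := by ring
        _ ≤ ‖B‖ * (‖A‖ * ‖x‖) ^ 2 := by gcongr; exact A.le_opNorm _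
        _ = _ := by ring
    have h2 : ‖B‖ * ‖A‖ ^ 2 * ‖x‖ ^ 2 ≤ ‖B‖ * ‖A‖ ^ 2 / a * ⟪A x, x⟫_ℝ := by
      calc ‖B‖ * ‖A‖ ^ 2 * ‖x‖ ^ 2 = ‖B‖ * ‖A‖ ^ 2 / a * (a * ‖x‖ ^ 2) := by field_simp
        _ ≤ _ := by gcongr; exact hA x
    have := neg_abs_le ⟪B (A x), A x⟫_ℝ
    simp only [q]
    linarith
  have hSbdd : BddBelow S := ⟨0, fun s hs => (hSpos s hs).le⟩
  have hSclosed : IsClosed S := by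
    simp only [S, Set.ofPred_forall]
    refine isClosed_iInter fun x => isClosed_le continuous_const ?_
    fun_prop
  have hs : sInf S ∈ S := hSclosed.csInf_mem hSne hSbdd
  set s := sInf S with hsdef
  have hs0 := hSpos s hs
  refine ⟨s, hs0, ?_⟩
  by_contra! hno
  let P : H →L[ℝ] H := A ∘L T ∘L A + s • A
  let D : H →L[ℝ] H := A ∘L C ∘L A
  have hG : ∀ x, (P - D) x = A (B (A x)) + s • A x := fun x => by
    simp only [P, D, hB, sub_apply, add_apply,
      ContinuousLinearMap.comp_apply, smul_apply, map_sub]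
    abel
  have hGq : ∀ x, ⟪(P - D) x, x⟫_ℝ = q s x := fun x => by
    rw [hG, inner_add_left, hAsymm, real_inner_smul_left]
  obtain ⟨d, hd, hcoer⟩ := P.coercive_of_injective_of_compact_perturbation D (mul_pos hs0 ha)
    (fun x => by
      have h1 : ⟪P x, x⟫_ℝ = ⟪T (A x), A x⟫_ℝ + s * ⟪A x, x⟫_ℝ := by
        simp only [P, add_apply, ContinuousLinearMap.comp_apply,
          smul_apply, inner_add_left, real_inner_smul_left, hAsymm (T (A x))]
      have := mul_le_mul_of_nonneg_left (hA x) hs0.le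
      rw [h1]
      linarith [hT (A x)])
    ((hC.comp_clm A).clm_comp A)
    (fun x y => by
      rw [hG, hG, inner_add_left, inner_add_right, hAsymm, hsymm, hAsymm, real_inner_smul_left,
        real_inner_smul_right, hAsymm])
    (fun x => by rw [hGq]; exact hs x)
    (fun x hx => by
      by_contra hx0
      refine hno x hx0 ?_
      rw [hG, ← map_smul, ← map_add, hAe] at hx
      have := e.map_eq_zero_iff.1 hx
      rw [neg_smul]
      exact eq_neg_of_add_eq_zero_left this)
  have hmem : s - d / (‖A‖ + 1) ∈ S := fun x => by
    have h1 := hcoer x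
    rw [hGq] at h1
    have h2 : ⟪A x, x⟫_ℝ ≤ (‖A‖ + 1) * ‖x‖ ^ 2 := by
      calc ⟪A x, x⟫_ℝ ≤ ‖A x‖ * ‖x‖ := real_inner_le_norm _ _
        _ ≤ (‖A‖ * ‖x‖) * ‖x‖ := by gcongr; exact A.le_opNorm _
        _ ≤ _ := by nlinarith [sq_nonneg ‖x‖]
    have h3 : d / (‖A‖ + 1) * ⟪A x, x⟫_ℝ ≤ d * ‖x‖ ^ 2 := by
      calc _ ≤ d / (‖A‖ + 1) * ((‖A‖ + 1) * ‖x‖ ^ 2) := by gcongr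
        _ = _ := by field_simp
    simp only [q] at h1 ⊢
    linarith
  have hpos : 0 < d / (‖A‖ + 1) := by positivity
  linarith [csInf_le hSbdd hmem]

end Hilbert

section SequenceSpace

variable {ι : Type*}

theorem lp.real_inner_eq_tsum (f g : lp (fun _ : ι => ℝ) 2) :
    ⟪f, g⟫_ℝ = ∑' i, f i * g i := by
  simp [lp.inner_eq_tsum, mul_comm]

theorem lp.summable_real_mul (f g : lp (fun _ : ι => ℝ) 2) : Summable fun i => f i * g i := by
  simpa [mul_comm] using lp.summable_inner (𝕜 := ℝ) f g

theorem memℓp_two_iff_summable_sq {f : ι → ℝ} : Memℓp f 2 ↔ Summable fun i => f i ^ 2 := by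
  rw [memℓp_gen_iff (by norm_num)]
  simp

/-- Reindexing of a square-summable sequence along a permutation of the index set. -/
noncomputable def lp.reindex (σ : ι ≃ ι) :
    lp (fun _ : ι => ℝ) 2 →L[ℝ] lp (fun _ : ι => ℝ) 2 :=
  LinearMap.mkContinuous
    { toFun := fun f => ⟨fun i => f (σ i), memℓp_two_iff_summable_sq.2
        (σ.summable_iff.2 (memℓp_two_iff_summable_sq.1 (lp.memℓp f)))⟩
      map_add' := fun _ _ => rfl
      map_smul' := fun _ _ => rfl } 1 (by
    intro f
    rw [one_mul]
    refine le_of_sq_le_sq ?_ (norm_nonneg _)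
    rw [← real_inner_self_eq_norm_sq, ← real_inner_self_eq_norm_sq, lp.real_inner_eq_tsum,
      lp.real_inner_eq_tsum]
    exact (σ.tsum_eq fun i => f i * f i).le)

@[simp]
theorem lp.reindex_apply (σ : ι ≃ ι) (f : lp (fun _ : ι => ℝ) 2) (i : ι) :
    lp.reindex σ f i = f (σ i) := rfl

theorem lp.norm_reindex_le (σ : ι ≃ ι) (f : lp (fun _ : ι => ℝ) 2) : ‖lp.reindex σ f‖ ≤ ‖f‖ := by
  simpa using (lp.reindex σ).le_of_opNorm_le (LinearMap.mkContinuous_norm_le _ zero_le_one _) f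

theorem lp.inner_reindex_left (σ : ι ≃ ι) (f g : lp (fun _ : ι => ℝ) 2) :
    ⟪lp.reindex σ f, g⟫_ℝ = ⟪f, lp.reindex σ.symm g⟫_ℝ := by
  rw [lp.real_inner_eq_tsum, lp.real_inner_eq_tsum,
    ← σ.tsum_eq fun i => f i * lp.reindex σ.symm g i]
  simp

/-- Multiplication by a summable sequence is a compact operator on `ℓ²`. -/
theorem lp.exists_compact_diagonal {d : ι → ℝ} (hd : Summable fun i => ‖d i‖) :
    ∃ K : lp (fun _ : ι => ℝ) 2 →L[ℝ] lp (fun _ : ι => ℝ) 2,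
      IsCompactOperator K ∧ ∀ f i, K f i = d i * f i := by
  classical
  let e : ι → lp (fun _ : ι => ℝ) 2 := fun i => lp.single 2 i (1 : ℝ)
  let R : ι → lp (fun _ : ι => ℝ) 2 →L[ℝ] lp (fun _ : ι => ℝ) 2 :=
    fun i => d i • InnerProductSpace.rankOne ℝ (e i) (e i)
  have he : ∀ i, ‖e i‖ = 1 := fun i => by simp [e, lp.norm_single]
  have hinner : ∀ i (f : lp (fun _ : ι => ℝ) 2), ⟪e i, f⟫_ℝ = f i := fun i f => by
    simp [e, lp.inner_single_left]
  have hR : Summable R := .of_norm (by simpa [R, norm_smul, he] using hd)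
  refine ⟨∑' i, R i, ?_, fun f j => ?_⟩
  · refine isCompactOperator_of_tendsto hR.hasSum (Filter.Eventually.of_forall fun s => ?_)
    refine Submodule.sum_mem (compactOperator (RingHom.id ℝ) _ _) fun i _ => ?_
    refine Submodule.smul_mem _ _ ?_
    have hid : IsCompactOperator (id : ℝ → ℝ) := isCompactOperator_id
    exact (hid.comp_clm (innerSL ℝ (e i))).clm_comp (ContinuousLinearMap.toSpanSingleton ℝ (e i))
  · have h := ((innerSL ℝ (e j)).comp (ContinuousLinearMap.apply ℝ _ f)).hasSum hR.hasSum
    have h2 : HasSum (fun i => if i = j then d j * f j else 0) ((∑' i, R i) f j) := by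
      convert! h using 1
      · ext i
        simp only [R, ContinuousLinearMap.comp_apply, ContinuousLinearMap.apply_apply,
          smul_apply, InnerProductSpace.rankOne_apply, innerSL_apply_apply, hinner]
        split_ifs with hij
        · subst hij; simp [e]
        · simp [e, Ne.symm hij]
      · simp [hinner]
    exact h2.unique (hasSum_ite_eq j _)

end SequenceSpace

/-- The local form of the discrete Jacobi identity for `-ε Δ + 1 - ψ²`: here `a, b, c` and
`x, y, z` are three consecutive values of `ψ` and of the test sequence. -/
theorem dnls_telescoping_le {ε a b c x y z : ℝ} (hε : 0 < ε) (hb : 0 < b) (hc : 0 < c)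
    (heq : -b + ε * (c + a - 2 * b) + b ^ 3 = 0) :
    ε * ((a / b * y ^ 2 - x * y) - (b / c * z ^ 2 - y * z))
      ≤ (-ε * (z + x - 2 * y) + y - b ^ 2 * y) * y := by
  have hpsi : 1 + 2 * ε - b ^ 2 = ε * (c + a) / b := by
    rw [eq_div_iff hb.ne']
    linarith
  have hkey : (-ε * (z + x - 2 * y) + y - b ^ 2 * y) * y
      - ε * ((a / b * y ^ 2 - x * y) - (b / c * z ^ 2 - y * z))
      = ε * ((c * y - b * z) ^ 2 / (b * c)) := by
    have : (-ε * (z + x - 2 * y) + y - b ^ 2 * y) * y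
        = (1 + 2 * ε - b ^ 2) * y ^ 2 - ε * (z + x) * y := by ring
    rw [this, hpsi]
    field_simp
    ring
  have : 0 ≤ ε * ((c * y - b * z) ^ 2 / (b * c)) := by positivity
  linarith

/-- A positive solution of the stationary dNLS equation makes the quadratic form of
`-ε Δ + 1 - ψ²` nonnegative. -/
theorem dnls_quadratic_form_nonneg {ε : ℝ} (hε : 0 < ε) {ψ w : ℤ → ℝ} (hpos : ∀ m, 0 < ψ m)
    (heq : ∀ m : ℤ, -ψ m + ε * (ψ (m + 1) + ψ (m - 1) - 2 * ψ m) + (ψ m) ^ 3 = 0)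
    (hw : Summable fun m => w m ^ 2)
    (hsum : Summable fun m : ℤ =>
      (-ε * (w (m + 1) + w (m - 1) - 2 * w m) + w m - (ψ m) ^ 2 * w m) * w m) :
    0 ≤ ∑' m : ℤ, (-ε * (w (m + 1) + w (m - 1) - 2 * w m) + w m - (ψ m) ^ 2 * w m) * w m := by
  have hw' : Summable fun m => w (m - 1) ^ 2 :=
    hw.comp_injective (Equiv.subRight (1 : ℤ)).injective
  let g : ℤ → ℝ := fun m => ψ (m - 1) / ψ m * w m ^ 2 - w (m - 1) * w m
  have hratio : ∀ m, ψ (m - 1) / ψ m ≤ (1 + 2 * ε) / ε := fun m => by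
    rw [div_le_div_iff₀ (hpos m) hε]
    nlinarith [heq m, mul_pos hε (hpos (m + 1)), pow_pos (hpos m) 3]
  have hg₁ : Summable fun m => ψ (m - 1) / ψ m * w m ^ 2 := by
    have hc : Summable fun m => (1 + 2 * ε) / ε * w m ^ 2 := hw.mul_left _
    refine hc.of_nonneg_of_le (fun m => ?_) (fun m => ?_)
    · have := hpos m
      have := hpos (m - 1)
      positivity
    · exact mul_le_mul_of_nonneg_right (hratio m) (sq_nonneg _)
  have hg₂ : Summable fun m => w (m - 1) * w m := by
    have hc : Summable fun m => w (m - 1) ^ 2 + w m ^ 2 := hw'.add hw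
    refine hc.of_norm_bounded fun m => ?_
    rw [Real.norm_eq_abs, abs_le]
    constructor <;> nlinarith [sq_nonneg (w (m - 1) + w m), sq_nonneg (w (m - 1) - w m),
      sq_nonneg (w (m - 1)), sq_nonneg (w m)]
  have hg : Summable g := hg₁.sub hg₂
  have hg' : Summable fun m => g (m + 1) :=
    hg.comp_injective (Equiv.addRight (1 : ℤ)).injective
  have hzero : ∑' m, ε * (g m - g (m + 1)) = 0 := by
    have h : ∑' m, g (m + 1) = ∑' m, g m := (Equiv.addRight (1 : ℤ)).tsum_eq g
    rw [tsum_mul_left, hg.tsum_sub hg', h, sub_self, mul_zero]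
  have hgsum : Summable fun m => ε * (g m - g (m + 1)) := (hg.sub hg').mul_left ε
  refine hzero.symm.le.trans (Summable.tsum_le_tsum (fun m => ?_) hgsum hsum)
  have h := dnls_telescoping_le (x := w (m - 1)) (y := w m) (z := w (m + 1)) hε (hpos m)
    (hpos (m + 1)) (heq m)
  simpa only [g, add_sub_cancel_right] using h

/-- Theorem 3 (transverse instability on the stripe lattice with `κ = 1`). Let
`μ = 1`, `ε > 0`, and let `ψ` be a positive solution of the stationary 1D dNLS
equation whose linearization `L₊(0)` has exactly one negative eigenvalue `-β`
(`β > 0`) with trivial kernel (encoded: an eigenvector `φ` with eigenvalue `-β`,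
strict positivity of the quadratic form on nonzero vectors orthogonal to `φ`), and
`L₊(0) + β ≥ 0`. Then, with `p₀ = √β`, for every `p` with `0 < |p| < p₀` the
stripe-lattice stability problem with `L₊(p) = L₊(0) + p²`, `L₋(p) = L₋(0) + p²`
admits a real eigenvalue `λ > 0`: the line soliton is transversely unstable. -/
theorem transverse_instability_stripe_kappa_plus (ε β : ℝ) (hε : 0 < ε) (hβ : 0 < β)
    (ψ : ℤ → ℝ) (hψ : Memℓp ψ 2) (hpos : ∀ m : ℤ, 0 < ψ m)
    (heq : ∀ m : ℤ, -ψ m + ε * (ψ (m + 1) + ψ (m - 1) - 2 * ψ m) + (ψ m) ^ 3 = 0)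
    (Lplus0 Lminus0 : (ℤ → ℝ) → ℤ → ℝ)
    (hLp : Lplus0 = fun U m => -ε * (U (m + 1) + U (m - 1) - 2 * U m)
      + U m - 3 * (ψ m) ^ 2 * U m)
    (hLm : Lminus0 = fun W m => -ε * (W (m + 1) + W (m - 1) - 2 * W m)
      + W m - (ψ m) ^ 2 * W m)
    (hev : ∃ φ : ℤ → ℝ, Memℓp φ 2 ∧ φ ≠ 0 ∧ (∀ m : ℤ, Lplus0 φ m = -β * φ m) ∧
      (∀ U : ℤ → ℝ, Memℓp U 2 → U ≠ 0 → (∑' m : ℤ, φ m * U m) = 0 →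
        0 < ∑' m : ℤ, Lplus0 U m * U m))
    (hker : ∀ U : ℤ → ℝ, Memℓp U 2 → (∀ m : ℤ, Lplus0 U m = 0) → U = 0)
    (hlb : ∀ U : ℤ → ℝ, Memℓp U 2 → 0 ≤ ∑' m : ℤ, (Lplus0 U m + β * U m) * U m) :
    ∀ p : ℝ, 0 < |p| → |p| < Real.sqrt β →
      ∃ lam : ℝ, 0 < lam ∧ ∃ U W : ℤ → ℝ, Memℓp U 2 ∧ Memℓp W 2 ∧
        ¬(U = 0 ∧ W = 0) ∧
        (∀ m : ℤ, Lplus0 U m + p ^ 2 * U m = -lam * W m) ∧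
        (∀ m : ℤ, Lminus0 W m + p ^ 2 * W m = lam * U m) := by
  intro p hp hpβ
  have hp2 : 0 < p ^ 2 := by rw [← sq_abs]; positivity
  have hpβ2 : p ^ 2 < β := by rw [← sq_abs]; exact (Real.lt_sqrt hp.le).1 hpβ
  obtain ⟨φ, hφ, hφ0, hφev, -⟩ := hev
  let H := lp (fun _ : ℤ => ℝ) 2
  let R : H →L[ℝ] H := lp.reindex (Equiv.addRight (1 : ℤ))
  let L : H →L[ℝ] H := lp.reindex (Equiv.addRight (1 : ℤ)).symm
  obtain ⟨K, hK, hKapply⟩ := lp.exists_compact_diagonal (d := fun m => ψ m ^ 2)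
    (by simpa using memℓp_two_iff_summable_sq.1 hψ)
  let T : H →L[ℝ] H := ε • ((2 : ℝ) • 1 - R - L) + (1 + p ^ 2) • 1
  have hRL : ∀ f g : H, ⟪R f, g⟫_ℝ = ⟪f, L g⟫_ℝ := fun f g => lp.inner_reindex_left _ f g
  have hLR : ∀ f g : H, ⟪L f, g⟫_ℝ = ⟪f, R g⟫_ℝ := fun f g => lp.inner_reindex_left _ f g
  have hTapply : ∀ (f : H) m, T f m
      = -ε * (f (m + 1) + f (m - 1) - 2 * f m) + (1 + p ^ 2) * f m := fun f m => by
    have : T f m = ε * (2 * f m - f (m + 1) - f (m - 1)) + (1 + p ^ 2) * f m := rfl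
    rw [this]
    ring
  have hTinner : ∀ f g : H, ⟪T f, g⟫_ℝ
      = ε * (2 * ⟪f, g⟫_ℝ - ⟪R f, g⟫_ℝ - ⟪L f, g⟫_ℝ) + (1 + p ^ 2) * ⟪f, g⟫_ℝ := fun f g => by
    simp [T, inner_add_left, inner_sub_left, real_inner_smul_left]
  have hTsymm : ∀ f g : H, ⟪T f, g⟫_ℝ = ⟪f, T g⟫_ℝ := fun f g => by
    rw [real_inner_comm (T g) f, hTinner, hTinner, hRL g, hLR g, real_inner_comm (L f) g,
      real_inner_comm (R f) g, real_inner_comm f g]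
    ring
  have hTnonneg : ∀ f : H, 0 ≤ ⟪T f, f⟫_ℝ := fun f => by
    have h1 : ⟪R f, f⟫_ℝ ≤ ‖f‖ ^ 2 := by
      calc ⟪R f, f⟫_ℝ ≤ ‖R f‖ * ‖f‖ := real_inner_le_norm _ _
        _ ≤ ‖f‖ * ‖f‖ := by gcongr; exact lp.norm_reindex_le _ f
        _ = _ := (sq _).symm
    have h2 : ⟪L f, f⟫_ℝ ≤ ‖f‖ ^ 2 := by rwa [hLR, real_inner_comm]
    rw [hTinner, real_inner_self_eq_norm_sq]
    have := mul_nonneg hε.le (by linarith : 0 ≤ 2 * ‖f‖ ^ 2 - ⟪R f, f⟫_ℝ - ⟪L f, f⟫_ℝ)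
    positivity
  have hKsymm : ∀ f g : H, ⟪K f, g⟫_ℝ = ⟪f, K g⟫_ℝ := fun f g => by
    rw [lp.real_inner_eq_tsum, lp.real_inner_eq_tsum]
    exact tsum_congr fun m => by rw [hKapply, hKapply]; ring
  have hAapply : ∀ (f : H) m, (T - K) f m = Lminus0 f m + p ^ 2 * f m := fun f m => by
    have : (T - K) f m = T f m - K f m := rfl
    rw [this, hTapply, hKapply, hLm]
    ring
  have hBapply : ∀ (f : H) m, (T - (3 : ℝ) • K) f m = Lplus0 f m + p ^ 2 * f m := fun f m => by
    have : (T - (3 : ℝ) • K) f m = T f m - 3 * K f m := rfl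
    rw [this, hTapply, hKapply, hLp]
    ring
  have hA : ∀ f : H, p ^ 2 * ‖f‖ ^ 2 ≤ ⟪(T - K) f, f⟫_ℝ := fun f => by
    have h1 := lp.summable_real_mul ((T - K) f) f
    have h2 := (lp.summable_real_mul f f).mul_left (p ^ 2)
    have h3 : ∀ m, Lminus0 f m * f m = (T - K) f m * f m - p ^ 2 * (f m * f m) := fun m => by
      rw [hAapply]; ring
    have h4 : Summable fun m => Lminus0 f m * f m := by simpa only [h3] using h1.sub h2
    have h5 : 0 ≤ ∑' m, Lminus0 f m * f m := by
      rw [hLm] at h4 ⊢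
      exact dnls_quadratic_form_nonneg hε hpos heq (memℓp_two_iff_summable_sq.1 (lp.memℓp f)) h4
    rw [tsum_congr h3, h1.tsum_sub h2, tsum_mul_left, ← lp.real_inner_eq_tsum,
      ← lp.real_inner_eq_tsum, real_inner_self_eq_norm_sq] at h5
    linarith
  let φ' : H := ⟨φ, hφ⟩
  have hneg : ⟪(T - (3 : ℝ) • K) φ', φ'⟫_ℝ < 0 := by
    have h1 : (T - (3 : ℝ) • K) φ' = (p ^ 2 - β) • φ' := by
      ext m
      rw [hBapply]
      change Lplus0 φ m + p ^ 2 * φ m = (p ^ 2 - β) * φ m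
      rw [hφev]
      ring
    have h2 : 0 < ‖φ'‖ := norm_pos_iff.2 fun h => hφ0 (congrArg Subtype.val h)
    rw [h1, real_inner_smul_left, real_inner_self_eq_norm_sq]
    exact mul_neg_of_neg_of_pos (by linarith) (by positivity)
  obtain ⟨s, hs, w, hw0, hw⟩ := (T - K).exists_neg_eigenvalue_mul_of_coercive T ((3 : ℝ) • K) hp2 hA
    (fun f g => by
      simp only [sub_apply, inner_sub_left, inner_sub_right, hTsymm, hKsymm])
    hTnonneg (hK.smul (3 : ℝ))
    (fun f g => by
      simp only [sub_apply, smul_apply, inner_sub_left, inner_sub_right, real_inner_smul_left,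
        real_inner_smul_right, hTsymm, hKsymm])
    ⟨φ', hneg⟩
  have hlam : 0 < √s := Real.sqrt_pos.2 hs
  let u : H := (√s)⁻¹ • (T - K) w
  refine ⟨√s, hlam, u, w, lp.memℓp u, lp.memℓp w, fun h => hw0 (lp.ext h.2), fun m => ?_,
    fun m => ?_⟩
  · have h1 : (T - (3 : ℝ) • K) u = -√s • w := by
      rw [map_smul, hw, smul_smul, mul_neg, ← div_eq_inv_mul, Real.div_sqrt]
    rw [← hBapply, h1]
    rfl
  · rw [← hAapply]
    change _ = √s * ((√s)⁻¹ * (T - K) w m)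
    rw [mul_inv_cancel_left₀ hlam.ne']
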